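/- Let d = 2 and suppose q = (q̄, q_n(q̄)) is a normalized central configuration with y_{n−1} = 0, x_n ≠ x_{n−1}, and x_{n−1} ≠ 0. Then the rank of the Jacobian matrix D RS at the corresponding point equals the rank of the Jacobian matrix DF^red(q̄). -/

import Mathlib

open scoped BigOperators

noncomputable section

/-- Points in `ℝ^d`, with the Euclidean norm. -/
abbrev Pt (d : ℕ) := EuclideanSpace ℝ (Fin d)

/-- `F_i(q) = −q_i + Σ_{j ≠ i} m_j (q_j − q_i)/‖q_j − q_i‖³`. -/
noncomputable def nbodyF {d n : ℕ} (m : Fin n → ℝ) (q : Fin n → Pt d) : Fin n → Pt d :=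
  fun i => -q i + ∑ j ∈ Finset.univ.erase i, (m j / ‖q j - q i‖ ^ 3) • (q j - q i)

/-- A configuration is collision-free if all bodies occupy distinct positions. -/
def CollisionFree {d n : ℕ} (q : Fin n → Pt d) : Prop :=
  ∀ i j, i ≠ j → q i ≠ q j

/-- A normalized central configuration: collision-free, center of mass at the origin,
and `F(q) = 0`. -/
def IsNCC {d n : ℕ} (m : Fin n → ℝ) (q : Fin n → Pt d) : Prop :=
  CollisionFree q ∧ (∑ i, m i • q i) = 0 ∧ nbodyF m q = 0

/-- Embedding of the reduced index set `{1,…,n−1}` into `{1,…,n}`. -/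
def emb {n : ℕ} (i : Fin (n - 1)) : Fin n := Fin.castLE (Nat.sub_le n 1) i

/-- Extend a reduced configuration `q̄ = (q_1,…,q_{n−1})` by the position of the last body,
`q_n(q̄) = −(1/m_n) Σ_{i<n} m_i q_i`, computed from the center of mass condition. -/
noncomputable def extendConfig {d n : ℕ} (m : Fin n → ℝ) (qbar : Fin (n - 1) → Pt d) :
    Fin n → Pt d :=
  fun i => if h : (i : ℕ) < n - 1 then qbar ⟨i, h⟩
    else (-(1 / m i)) • ∑ j : Fin (n - 1), m (emb j) • qbar j

/-- The center-of-mass reduced map `F^red_i(q̄) = F_i(q_1,…,q_{n−1},q_n(q̄))`, `i = 1,…,n−1`. -/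
noncomputable def Fred {d n : ℕ} (m : Fin n → ℝ) (qbar : Fin (n - 1) → Pt d) :
    Fin (n - 1) → Pt d :=
  fun i => nbodyF m (extendConfig m qbar) (emb i)

/-- The Jacobian matrix of `F`, rows and columns indexed by (body, coordinate). -/
noncomputable def jacF {d n : ℕ} (m : Fin n → ℝ) (q : Fin n → Pt d) :
    Matrix (Fin n × Fin d) (Fin n × Fin d) ℝ :=
  fun p p' =>
    fderiv ℝ (fun q' : Fin n → Pt d => nbodyF m q' p.1 p.2) q
      (Pi.single p'.1 (EuclideanSpace.single p'.2 (1 : ℝ)))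

/-- The Jacobian matrix of `F^red`, rows and columns indexed by (body, coordinate). -/
noncomputable def jacFred {d n : ℕ} (m : Fin n → ℝ) (qbar : Fin (n - 1) → Pt d) :
    Matrix (Fin (n - 1) × Fin d) (Fin (n - 1) × Fin d) ℝ :=
  fun p p' =>
    fderiv ℝ (fun q' : Fin (n - 1) → Pt d => Fred m q' p.1 p.2) qbar
      (Pi.single p'.1 (EuclideanSpace.single p'.2 (1 : ℝ)))

/-- The Jacobian matrix of the planar reduced system `RS`: it is obtained from `DF^red`
by removing the row corresponding to `F^red_{n−1,y}` and the column corresponding to the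
variable `y_{n−1}` (here `x = 0`, `y = 1`, and the body of paper-index `n−1` is `⟨n−2,_⟩`). -/
noncomputable def DRS2 {n : ℕ} (hn : 3 ≤ n) (m : Fin n → ℝ) (qbar : Fin (n - 1) → Pt 2) :
    Matrix {p : Fin (n - 1) × Fin 2 // p ≠ (⟨n - 2, by omega⟩, 1)}
      {p : Fin (n - 1) × Fin 2 // p ≠ (⟨n - 2, by omega⟩, 1)} ℝ :=
  (jacFred m qbar).submatrix Subtype.val Subtype.val

section RankDeletion

variable {ι κ K : Type*} [Fintype κ] [DecidableEq κ] [Field K]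

/-- Deleting a column that takes part in a linear relation does not change the rank. -/
theorem Matrix.rank_submatrix_ne_of_mulVec_eq_zero [Fintype ι] (A : Matrix ι κ K) (k : κ)
    (v : κ → K) (hv : A.mulVec v = 0) (hk : v k ≠ 0) :
    (A.submatrix id (Subtype.val : {p // p ≠ k} → κ)).rank = A.rank := by
  rw [Matrix.rank_eq_finrank_span_cols, Matrix.rank_eq_finrank_span_cols]
  suffices h : Submodule.span K
      (Set.range (A.submatrix id (Subtype.val : {p // p ≠ k} → κ)).col) =
      Submodule.span K (Set.range A.col) by rw [h]
  have hcol : ∀ p : {p // p ≠ k},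
      (A.submatrix id (Subtype.val : {p // p ≠ k} → κ)).col p = A.col p := fun _ => rfl
  apply le_antisymm
  · refine Submodule.span_mono ?_
    rintro _ ⟨p, rfl⟩
    exact ⟨p, rfl⟩
  · rw [Submodule.span_le]
    rintro _ ⟨p, rfl⟩
    by_cases hp : p = k
    · subst hp
      have hrel : v p • A.col p = -∑ j ∈ Finset.univ.erase p, v j • A.col j := by
        rw [eq_neg_iff_add_eq_zero,
          Finset.add_sum_erase _ (fun j => v j • A.col j) (Finset.mem_univ p)]
        rw [← hv]
        ext i
        simp [Matrix.mulVec, dotProduct, mul_comm]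
      rw [SetLike.mem_coe, ← Submodule.smul_mem_iff _ hk, hrel]
      refine Submodule.neg_mem _ (Submodule.sum_mem _ fun j hj => Submodule.smul_mem _ _ ?_)
      exact Submodule.subset_span ⟨⟨j, Finset.ne_of_mem_erase hj⟩, rfl⟩
    · exact Submodule.subset_span ⟨⟨p, hp⟩, rfl⟩

/-- Deleting a row and a column that both take part in linear relations does not change
the rank. -/
theorem Matrix.rank_submatrix_ne_ne (A : Matrix κ κ K) (k : κ) (u v : κ → K)
    (hv : A.mulVec v = 0) (hvk : v k ≠ 0) (hu : A.vecMul u = 0) (huk : u k ≠ 0) :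
    (A.submatrix (Subtype.val : {p // p ≠ k} → κ)
      (Subtype.val : {p // p ≠ k} → κ)).rank = A.rank := by
  have h1 := Matrix.rank_submatrix_ne_of_mulVec_eq_zero A.transpose k u
    (by rw [Matrix.mulVec_transpose, hu]) huk
  have h2 := Matrix.rank_submatrix_ne_of_mulVec_eq_zero
    (A.submatrix (Subtype.val : {p // p ≠ k} → κ) id) k v
    (by ext i; exact congrFun hv i) hvk
  rw [Matrix.rank_transpose] at h1
  rw [← h1, ← Matrix.rank_transpose (A.transpose.submatrix id _)]
  exact h2

end RankDeletion

section Identities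

variable {d n : ℕ} (m : Fin n → ℝ)

theorem nbodyF_apply (q : Fin n → Pt d) (i : Fin n) (c : Fin d) :
    nbodyF m q i c = -q i c + ∑ j, m j / ‖q j - q i‖ ^ 3 * (q j c - q i c) := by
  have h := Finset.add_sum_erase Finset.univ
    (fun j => m j / ‖q j - q i‖ ^ 3 * (q j c - q i c)) (Finset.mem_univ i)
  simp only [sub_self, mul_zero, zero_add] at h
  rw [← h]
  simp [nbodyF]

theorem sum_eq_zero_of_antisymm {ι : Type*} [Fintype ι] (c : ι → ι → ℝ)
    (h : ∀ i j, c i j = -c j i) : ∑ i, ∑ j, c i j = 0 := by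
  have h1 : ∑ i, ∑ j, c i j = -∑ i, ∑ j, c i j := by
    conv_lhs => rw [Finset.sum_comm]
    simp only [← Finset.sum_neg_distrib]
    exact Finset.sum_congr rfl fun i _ => Finset.sum_congr rfl fun j _ => h j i
  linarith

theorem sum_mass_mul_nbodyF (q : Fin n → Pt d) (c : Fin d) :
    ∑ i, m i * nbodyF m q i c = -∑ i, m i * q i c := by
  have h := sum_eq_zero_of_antisymm
    (fun i j => m i * (m j / ‖q j - q i‖ ^ 3 * (q j c - q i c)))
    (fun i j => by rw [norm_sub_rev]; ring)
  simp only [nbodyF_apply, mul_add, Finset.sum_add_distrib, Finset.mul_sum, h]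
  simp

theorem sum_mass_mul_cross_nbodyF (q : Fin n → Pt 2) :
    ∑ i, m i * (q i 0 * nbodyF m q i 1 - q i 1 * nbodyF m q i 0) = 0 := by
  rw [← sum_eq_zero_of_antisymm
    (fun i j => m i * (m j / ‖q j - q i‖ ^ 3 * (q i 0 * q j 1 - q i 1 * q j 0)))
    (fun i j => by rw [norm_sub_rev]; ring)]
  refine Finset.sum_congr rfl fun i _ => ?_
  rw [← Finset.mul_sum]
  congr 1
  rw [nbodyF_apply, nbodyF_apply, mul_add, mul_add, Finset.mul_sum, Finset.mul_sum]
  rw [show ∀ a b c e : ℝ, q i 0 * -a + b - (c + e) = b - e + (q i 0 * -a - c) by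
    intros; ring, ← Finset.sum_sub_distrib]
  rw [show q i 0 * -q i 1 - q i 1 * -q i 0 = 0 by ring, add_zero]
  exact Finset.sum_congr rfl fun j _ => by ring

theorem sum_eq_sum_emb_of_last_eq_zero (hn : 0 < n) (f : Fin n → ℝ)
    (hf : f ⟨n - 1, by omega⟩ = 0) : ∑ i, f i = ∑ i : Fin (n - 1), f (emb i) := by
  obtain ⟨k, rfl⟩ : ∃ k, n = k + 1 := ⟨n - 1, by omega⟩
  rw [Fin.sum_univ_castSucc]
  change _ + f ⟨k + 1 - 1, _⟩ = _
  rw [hf, add_zero]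
  rfl

theorem extendConfig_emb (q : Fin (n - 1) → Pt d) (i : Fin (n - 1)) :
    extendConfig m q (emb i) = q i := by
  simp [extendConfig, emb]

theorem sum_mass_smul_extendConfig (hm : ∀ i, 0 < m i) (hn : 0 < n)
    (q : Fin (n - 1) → Pt d) : ∑ i, m i • extendConfig m q i = 0 := by
  obtain ⟨k, rfl⟩ : ∃ k, n = k + 1 := ⟨n - 1, by omega⟩
  rw [Fin.sum_univ_castSucc]
  have h0 : ∀ i : Fin k, extendConfig m q i.castSucc = q i := extendConfig_emb m q
  have h1 : extendConfig m q (Fin.last k) =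
      (-(1 / m (Fin.last k))) • ∑ j : Fin k, m j.castSucc • q j := by
    rw [extendConfig, dif_neg (by simp)]
    rfl
  simp only [h0, h1, smul_smul]
  rw [mul_neg, mul_one_div_cancel (hm _).ne', neg_smul, one_smul]
  exact add_neg_cancel _

theorem sum_mass_mul_cross_Fred (hm : ∀ i, 0 < m i) (hn : 0 < n) (q : Fin (n - 1) → Pt 2) :
    ∑ i, m (emb i) * ((q i 0 - extendConfig m q ⟨n - 1, by omega⟩ 0) * Fred m q i 1
      - (q i 1 - extendConfig m q ⟨n - 1, by omega⟩ 1) * Fred m q i 0) = 0 := by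
  set Q := extendConfig m q with hQ
  set l : Fin n := ⟨n - 1, by omega⟩ with hl
  have hF : ∀ c, ∑ i, m i * nbodyF m Q i c = 0 := fun c => by
    have h := congrArg (fun x : Pt 2 => x c) (sum_mass_smul_extendConfig m hm hn q)
    rw [sum_mass_mul_nbodyF, neg_eq_zero]
    simpa using h
  have hsum : ∑ i, m i * ((Q i 0 - Q l 0) * nbodyF m Q i 1
      - (Q i 1 - Q l 1) * nbodyF m Q i 0) = 0 := by
    calc _ = ∑ i, m i * (Q i 0 * nbodyF m Q i 1 - Q i 1 * nbodyF m Q i 0)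
          - Q l 0 * ∑ i, m i * nbodyF m Q i 1 + Q l 1 * ∑ i, m i * nbodyF m Q i 0 := by
          rw [Finset.mul_sum, Finset.mul_sum, ← Finset.sum_sub_distrib,
            ← Finset.sum_add_distrib]
          exact Finset.sum_congr rfl fun i _ => by ring
      _ = 0 := by rw [sum_mass_mul_cross_nbodyF, hF, hF]; ring
  rw [sum_eq_sum_emb_of_last_eq_zero hn _ (by rw [← hl]; ring)] at hsum
  rw [← hsum]
  refine Finset.sum_congr rfl fun i _ => ?_
  rw [show Q (emb i) = q i from extendConfig_emb m q i]
  rfl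

theorem extendConfig_map (L : Pt d →ₗ[ℝ] Pt d) (q : Fin (n - 1) → Pt d) (i : Fin n) :
    extendConfig m (fun j => L (q j)) i = L (extendConfig m q i) := by
  unfold extendConfig
  split_ifs <;> simp [map_sum]

theorem nbodyF_map (L : Pt d →ₗ[ℝ] Pt d) (hL : ∀ x, ‖L x‖ = ‖x‖) (q : Fin n → Pt d)
    (i : Fin n) : nbodyF m (fun j => L (q j)) i = L (nbodyF m q i) := by
  have hL' : ∀ x y, ‖L x - L y‖ = ‖x - y‖ := fun x y => by rw [← map_sub, hL]
  simp only [nbodyF, map_add, map_neg, map_sum, map_smul, map_sub, hL']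

theorem Fred_map (L : Pt d →ₗ[ℝ] Pt d) (hL : ∀ x, ‖L x‖ = ‖x‖) (q : Fin (n - 1) → Pt d)
    (i : Fin (n - 1)) : Fred m (fun j => L (q j)) i = L (Fred m q i) := by
  rw [Fred, show extendConfig m (fun j => L (q j)) = fun j => L (extendConfig m q j) from
    funext (extendConfig_map m L q), nbodyF_map m L hL]
  rfl

theorem differentiable_extendConfig (i : Fin n) :
    Differentiable ℝ fun q : Fin (n - 1) → Pt d => extendConfig m q i := by
  unfold extendConfig
  split_ifs <;> fun_prop

theorem differentiableAt_Fred (q : Fin (n - 1) → Pt d)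
    (hq : CollisionFree (extendConfig m q)) (i : Fin (n - 1)) (c : Fin d) :
    DifferentiableAt ℝ (fun q' => Fred m q' i c) q := by
  suffices h : DifferentiableAt ℝ (fun q' => Fred m q' i) q by
    fun_prop
  unfold Fred nbodyF
  have hE := fun j => differentiable_extendConfig (d := d) m j q
  refine (hE _).neg.add (DifferentiableAt.fun_sum fun j hj => ?_)
  have hne : extendConfig m q j - extendConfig m q (emb i) ≠ 0 :=
    sub_ne_zero.mpr (hq _ _ (Finset.ne_of_mem_erase hj))
  have hd := (hE j).fun_sub (hE (emb i))
  have hc : DifferentiableAt ℝ (fun q' : Fin (n - 1) → Pt d =>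
      m j / ‖extendConfig m q' j - extendConfig m q' (emb i)‖ ^ 3) q := by
    simp only [div_eq_mul_inv]
    exact (((hd.norm ℝ hne).fun_pow 3).fun_inv
      (pow_ne_zero 3 (norm_ne_zero_iff.mpr hne))).const_mul (m j)
  exact hc.smul hd

theorem jacFred_mulVec (q w : Fin (n - 1) → Pt d) (p : Fin (n - 1) × Fin d) :
    (jacFred m q).mulVec (fun p' => w p'.1 p'.2) p =
      fderiv ℝ (fun q' => Fred m q' p.1 p.2) q w := by
  have hw : w = ∑ p' : Fin (n - 1) × Fin d,
      w p'.1 p'.2 • (Pi.single p'.1 (EuclideanSpace.single p'.2 (1 : ℝ)) :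
        Fin (n - 1) → Pt d) := by
    ext i c
    simp only [Finset.sum_apply, Fintype.sum_prod_type, Pi.smul_apply]
    simp [Pi.single_apply, apply_ite]
  conv_rhs => rw [hw]
  simp only [map_sum, map_smul, Matrix.mulVec, dotProduct, jacFred, smul_eq_mul]
  exact Finset.sum_congr rfl fun _ _ => mul_comm _ _

end Identities

/-- Rotation of the plane by a right angle. -/
def quarterTurn : Pt 2 →ₗ[ℝ] Pt 2 := Matrix.toEuclideanLin !![0, -1; 1, 0]

theorem quarterTurn_zero (x : Pt 2) : quarterTurn x 0 = -x 1 := by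
  simp [quarterTurn, Matrix.toLpLin_apply, dotProduct]

theorem quarterTurn_one (x : Pt 2) : quarterTurn x 1 = x 0 := by
  simp [quarterTurn, Matrix.toLpLin_apply, dotProduct]

theorem norm_cos_smul_add_sin_smul_quarterTurn (t : ℝ) (x : Pt 2) :
    ‖(Real.cos t • LinearMap.id + Real.sin t • quarterTurn : Pt 2 →ₗ[ℝ] Pt 2) x‖ = ‖x‖ := by
  rw [EuclideanSpace.norm_eq, EuclideanSpace.norm_eq]
  congr 1
  simp only [Fin.sum_univ_two, Real.norm_eq_abs, sq_abs, LinearMap.add_apply,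
    LinearMap.smul_apply, LinearMap.id_apply, PiLp.add_apply, PiLp.smul_apply, smul_eq_mul,
    quarterTurn_zero, quarterTurn_one]
  linear_combination (x 0 ^ 2 + x 1 ^ 2) * Real.sin_sq_add_cos_sq t

section Kernels

variable {n : ℕ} (m : Fin n → ℝ) (q : Fin (n - 1) → Pt 2)

theorem fderiv_Fred_quarterTurn (hq : CollisionFree (extendConfig m q)) (hF : Fred m q = 0)
    (i : Fin (n - 1)) (c : Fin 2) :
    fderiv ℝ (fun q' => Fred m q' i c) q (fun j => quarterTurn (q j)) = 0 := by
  let γ : ℝ → Fin (n - 1) → Pt 2 := fun t =>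
    Real.cos t • q + Real.sin t • fun j => quarterTurn (q j)
  have hγ0 : γ 0 = q := by simp [γ]
  have hγ : HasDerivAt γ (fun j => quarterTurn (q j)) 0 := by
    have h := ((Real.hasDerivAt_cos 0).smul_const q).fun_add
      ((Real.hasDerivAt_sin 0).smul_const fun j => quarterTurn (q j))
    simp only [Real.sin_zero, Real.cos_zero, neg_zero, zero_smul, one_smul, zero_add] at h
    exact h
  have hd := differentiableAt_Fred m q hq i c
  rw [← hγ0] at hd
  have hcomp := hd.hasFDerivAt.comp_hasDerivAt 0 hγ
  have hzero : (fun q' => Fred m q' i c) ∘ γ = fun _ => 0 := by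
    funext t
    have h := Fred_map m _ (norm_cos_smul_add_sin_smul_quarterTurn t) q i
    rw [hF, Pi.zero_apply, map_zero] at h
    exact congrArg (fun x : Pt 2 => x c) h
  rw [hzero, hγ0] at hcomp
  exact hcomp.unique (hasDerivAt_const _ _)

theorem sum_mass_mul_cross_fderiv_Fred (hm : ∀ i, 0 < m i) (hn : 0 < n)
    (hq : CollisionFree (extendConfig m q)) (hF : Fred m q = 0) (w : Fin (n - 1) → Pt 2) :
    ∑ i, m (emb i) *
      ((q i 0 - extendConfig m q ⟨n - 1, by omega⟩ 0) *
          fderiv ℝ (fun q' => Fred m q' i 1) q w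
        - (q i 1 - extendConfig m q ⟨n - 1, by omega⟩ 1) *
          fderiv ℝ (fun q' => Fred m q' i 0) q w) = 0 := by
  have hF0 : ∀ i c, Fred m q i c = 0 := fun i c => by rw [hF]; rfl
  have hprod : ∀ i (c e : Fin 2), HasFDerivAt
      (fun q' : Fin (n - 1) → Pt 2 =>
        (q' i c - extendConfig m q' ⟨n - 1, by omega⟩ c) * Fred m q' i e)
      ((q i c - extendConfig m q ⟨n - 1, by omega⟩ c) •
        fderiv ℝ (fun q' => Fred m q' i e) q) q := fun i c e => by
    have hE := differentiable_extendConfig (d := 2) m ⟨n - 1, by omega⟩ q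
    have hA : DifferentiableAt ℝ (fun q' : Fin (n - 1) → Pt 2 =>
        q' i c - extendConfig m q' ⟨n - 1, by omega⟩ c) q := by fun_prop
    have h := hA.hasFDerivAt.mul (differentiableAt_Fred m q hq i e).hasFDerivAt
    rw [hF0, zero_smul, add_zero] at h
    exact h
  have hsum := HasFDerivAt.fun_sum (u := Finset.univ) fun i _ =>
    ((hprod i 0 1).sub (hprod i 1 0)).const_mul (m (emb i))
  have hzero := (hasFDerivAt_const (𝕜 := ℝ) (0 : ℝ) q).congr_of_eventuallyEq
    (Filter.Eventually.of_forall fun q' => sum_mass_mul_cross_Fred m hm hn q')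
  have h := congrArg (fun L : (Fin (n - 1) → Pt 2) →L[ℝ] ℝ => L w) (hsum.unique hzero)
  simpa using h

end Kernels

/-- for a planar nCC with `y_{n−1} = 0`, `x_n ≠ x_{n−1}`, `x_{n−1} ≠ 0`,
the rank of `D RS` equals the rank of `DF^red(q̄)`. -/
theorem stmt7 {n : ℕ} (hn : 3 ≤ n) (m : Fin n → ℝ) (hm : ∀ i, 0 < m i)
    (qbar : Fin (n - 1) → Pt 2) (hcc : IsNCC m (extendConfig m qbar))
    (hy : qbar ⟨n - 2, by omega⟩ 1 = 0)
    (hx1 : extendConfig m qbar ⟨n - 1, by omega⟩ 0 ≠ qbar ⟨n - 2, by omega⟩ 0)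
    (hx2 : qbar ⟨n - 2, by omega⟩ 0 ≠ 0) :
    (DRS2 hn m qbar).rank = (jacFred m qbar).rank := by
  obtain ⟨hcf, -, hF⟩ := hcc
  have hFred : Fred m qbar = 0 := funext fun i => congrFun hF (emb i)
  refine Matrix.rank_submatrix_ne_ne (jacFred m qbar) _
    (fun p => m (emb p.1) * ![-(qbar p.1 1 - extendConfig m qbar ⟨n - 1, by omega⟩ 1),
      qbar p.1 0 - extendConfig m qbar ⟨n - 1, by omega⟩ 0] p.2)
    (fun p => quarterTurn (qbar p.1) p.2) ?_ ?_ ?_ ?_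
  · ext p
    rw [jacFred_mulVec m qbar (fun j => quarterTurn (qbar j))]
    exact fderiv_Fred_quarterTurn m qbar hcf hFred p.1 p.2
  · rwa [quarterTurn_one]
  · ext p
    rw [Pi.zero_apply, ← sum_mass_mul_cross_fderiv_Fred m qbar hm (by omega) hcf hFred
      (Pi.single p.1 (EuclideanSpace.single p.2 (1 : ℝ)))]
    simp only [Matrix.vecMul, dotProduct, Fintype.sum_prod_type, Fin.sum_univ_two, jacFred]
    refine Finset.sum_congr rfl fun i _ => ?_
    simp only [Matrix.cons_val_zero, Matrix.cons_val_one]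
    ring
  · exact mul_ne_zero (hm _).ne' (sub_ne_zero.mpr hx1.symm)
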